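/- Let σ ∈ S_a and τ ∈ S_b. Then |S_n(σ,τ)| / n! converges to 1/(a! b!) as n → ∞. -/

import Mathlib

open Finset

namespace QT

/-- The major index of a permutation of `Fin n` (sum of descents,
with positions written `1,...,n-1` as in one-line notation). -/
def maj {n : ℕ} (π : Equiv.Perm (Fin n)) : ℕ :=
  ∑ i ∈ Finset.range n,
    if h : i + 1 < n then
      (if π ⟨i + 1, h⟩ < π ⟨i, by omega⟩ then i + 1 else 0)
    else 0

/-- `imaj π = maj π⁻¹`. -/
def imaj {n : ℕ} (π : Equiv.Perm (Fin n)) : ℕ := maj π⁻¹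

/-- The permutation of `Fin k` order-isomorphic to the word `v 0, v 1, ..., v (k-1)`. -/
noncomputable def standardize {n k : ℕ} (v : Fin k → Fin n) (hv : Function.Injective v) :
    Equiv.Perm (Fin k) :=
  Equiv.ofBijective
    (fun i => (Finset.orderIsoOfFin (Finset.image v Finset.univ)
        (by rw [Finset.card_image_of_injective _ hv, Finset.card_univ, Fintype.card_fin])).symm
        ⟨v i, Finset.mem_image_of_mem v (Finset.mem_univ i)⟩)
    (Finite.injective_iff_bijective.mp (fun i j hij => by
      have h2 := (Finset.orderIsoOfFin _ _).symm.injective hij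
      exact hv (congrArg Subtype.val h2)))

/-- `π^{≤k}` : the permutation of `Fin k` order-isomorphic to the first `k` letters of `π`. -/
noncomputable def pInit {n : ℕ} (π : Equiv.Perm (Fin n)) (k : ℕ) (hk : k ≤ n) :
    Equiv.Perm (Fin k) :=
  standardize (fun i => π (Fin.castLE hk i))
    (fun i j h => Fin.castLE_injective hk (π.injective h))

/-- `π^{>k}` : the permutation of `Fin (n-k)` order-isomorphic to the last `n - k` letters of `π`. -/
noncomputable def pTail {n : ℕ} (π : Equiv.Perm (Fin n)) (k : ℕ) :
    Equiv.Perm (Fin (n - k)) :=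
  standardize (fun i => π ⟨k + (i : ℕ), by have := i.isLt; omega⟩)
    (fun i j h => by
      have h2 : k + (i : ℕ) = k + (j : ℕ) := congrArg Fin.val (π.injective h)
      exact Fin.ext (by omega))

/-- `π_{≤k}` : the permutation of `Fin k` order-isomorphic to the subword of `π`
consisting of the `k` smallest values.  (Equivalently `((π⁻¹)^{≤k})⁻¹`.) -/
noncomputable def vLow {n : ℕ} (π : Equiv.Perm (Fin n)) (k : ℕ) (hk : k ≤ n) :
    Equiv.Perm (Fin k) := (pInit π⁻¹ k hk)⁻¹

/-- `π_{>k}` : the permutation of `Fin (n-k)` order-isomorphic to the subword of `π`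
consisting of the values `> k`.  (Equivalently `((π⁻¹)^{>k})⁻¹`.) -/
noncomputable def vHigh {n : ℕ} (π : Equiv.Perm (Fin n)) (k : ℕ) :
    Equiv.Perm (Fin (n - k)) := (pTail π⁻¹ k)⁻¹

/-- The set `I_n` of involutions in `S_n`. -/
def involutions (n : ℕ) : Finset (Equiv.Perm (Fin n)) :=
  Finset.univ.filter fun π => π * π = 1

-- `I_n(σ) = {π ∈ I_n : π_{≤m} = σ}`.
open scoped Classical in
noncomputable def involutionsC (n : ℕ) {m : ℕ} (σ : Equiv.Perm (Fin m)) :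
    Finset (Equiv.Perm (Fin n)) :=
  (involutions n).filter fun π => ∃ h : m ≤ n, vLow π m h = σ

-- `S_n(σ,τ) = {π ∈ S_n : π_{≤a} = σ, π^{≤b} = τ}`.
open scoped Classical in
noncomputable def permsC (n : ℕ) {a b : ℕ} (σ : Equiv.Perm (Fin a)) (τ : Equiv.Perm (Fin b)) :
    Finset (Equiv.Perm (Fin n)) :=
  Finset.univ.filter fun π => ∃ (ha : a ≤ n) (hb : b ≤ n), vLow π a ha = σ ∧ pInit π b hb = τ

-- The j-set `J(σ) = {j : σ^{≤j} is an involution}`.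
open scoped Classical in
noncomputable def jSet {m : ℕ} (σ : Equiv.Perm (Fin m)) : Finset ℕ :=
  (Finset.range (m + 1)).filter fun j => ∃ h : j ≤ m, pInit σ j h * pInit σ j h = 1

-- The j₂-set `J(σ,τ) = {j : σ^{≤j} = τ_{≤j}}`.
open scoped Classical in
noncomputable def j2Set {a b : ℕ} (σ : Equiv.Perm (Fin a)) (τ : Equiv.Perm (Fin b)) :
    Finset ℕ :=
  (Finset.range (min a b + 1)).filter fun j =>
    ∃ (ha : j ≤ a) (hb : j ≤ b), pInit σ j ha = vLow τ j hb

/-- A set of nonnegative integers is a j₂-set if it is `J(σ,τ)` for some pair of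
permutations. -/
def IsJ2Set (S : Finset ℕ) : Prop :=
  ∃ (a b : ℕ) (σ : Equiv.Perm (Fin a)) (τ : Equiv.Perm (Fin b)), S = j2Set σ τ

-- The number of j₂-sets with largest element `n`.
open scoped Classical in
noncomputable def j2count (n : ℕ) : ℕ :=
  ((Finset.range (n + 1)).powerset.filter
    fun S => IsJ2Set S ∧ n ∈ S ∧ ∀ x ∈ S, x ≤ n).card

/-- `[n]_q = 1 + q + ⋯ + q^{n-1}`. -/
def qInt (q : ℝ) (n : ℕ) : ℝ := ∑ i ∈ Finset.range n, q ^ i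

/-- The q-factorial `[n]_q! = ∏_{i=1}^n (1 + q + ⋯ + q^{i-1})`. -/
def qFact (q : ℝ) (n : ℕ) : ℝ := ∏ i ∈ Finset.range n, qInt q (i + 1)

/-- The Gaussian binomial coefficient `[n choose k]_q = [n]_q!/([k]_q! [n-k]_q!)`,
defined via the q-Pascal recursion. -/
def qBinom (q : ℝ) : ℕ → ℕ → ℝ
  | _, 0 => 1
  | 0, _ + 1 => 0
  | n + 1, k + 1 => qBinom q n k + q ^ (k + 1) * qBinom q n (k + 1)

/-- `t_n(q) = Σ_{π ∈ I_n} q^{maj π}`. -/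
noncomputable def tq (q : ℝ) (n : ℕ) : ℝ := ∑ π ∈ involutions n, q ^ maj π

/-- `A_n(p,q) = Σ_{π ∈ S_n} p^{imaj π} q^{maj π}`. -/
noncomputable def Apq (p q : ℝ) (n : ℕ) : ℝ :=
  ∑ π : Equiv.Perm (Fin n), p ^ imaj π * q ^ maj π

theorem standardize_lt_iff {n k : ℕ} (v : Fin k → Fin n) (hv : Function.Injective v)
    (i j : Fin k) : standardize v hv i < standardize v hv j ↔ v i < v j := by
  simp [standardize]

theorem pInit_lt_iff {n k : ℕ} (π : Equiv.Perm (Fin n)) (hk : k ≤ n) (i j : Fin k) :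
    pInit π k hk i < pInit π k hk j ↔ π (Fin.castLE hk i) < π (Fin.castLE hk j) :=
  standardize_lt_iff _ _ i j

/-- A permutation of `Fin k` is determined by the relative order of its letters. -/
theorem perm_eq_of_lt_iff {k : ℕ} {ρ κ : Equiv.Perm (Fin k)}
    (h : ∀ i j, ρ i < ρ j ↔ κ i < κ j) : ρ = κ := by
  have hmono : StrictMono (κ * ρ⁻¹) := fun i j hij => by
    have := h (ρ⁻¹ i) (ρ⁻¹ j)
    simp only [← Equiv.Perm.mul_apply, mul_inv_cancel, Equiv.Perm.one_apply] at this
    exact this.1 hij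
  have hid : (hmono.orderIsoOfSurjective _ (κ * ρ⁻¹).surjective) = OrderIso.refl _ :=
    Subsingleton.elim _ _
  ext i
  have h1 := congrArg (fun e : Fin k ≃o Fin k => e (ρ i)) hid
  have h2 : κ i = ρ i := by simpa using h1
  rw [h2]

/-- The permutation of `Fin n` acting as `κ` on the first `k` elements and fixing the others. -/
noncomputable def extendPerm {n k : ℕ} (hk : k ≤ n) : Equiv.Perm (Fin k) →* Equiv.Perm (Fin n) :=
  Equiv.Perm.viaEmbeddingHom (Fin.castLEEmb hk)

theorem extendPerm_castLE {n k : ℕ} (hk : k ≤ n) (κ : Equiv.Perm (Fin k)) (i : Fin k) :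
    extendPerm hk κ (Fin.castLE hk i) = Fin.castLE hk (κ i) :=
  Equiv.Perm.viaEmbedding_apply κ (Fin.castLEEmb hk) i

theorem extendPerm_of_le {n k : ℕ} (hk : k ≤ n) (κ : Equiv.Perm (Fin k)) {x : Fin n}
    (hx : k ≤ (x : ℕ)) : extendPerm hk κ x = x := by
  refine Equiv.Perm.viaEmbedding_apply_of_notMem κ (Fin.castLEEmb hk) x ?_
  rintro ⟨i, rfl⟩
  have := i.isLt
  simp at hx
  omega

theorem le_extendPerm_iff {n k : ℕ} (hk : k ≤ n) (κ : Equiv.Perm (Fin k)) (x : Fin n) :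
    k ≤ (extendPerm hk κ x : ℕ) ↔ k ≤ (x : ℕ) := by
  rcases le_or_gt k (x : ℕ) with hx | hx
  · rw [extendPerm_of_le hk κ hx]
  · have : x = Fin.castLE hk ⟨x, hx⟩ := rfl
    rw [this, extendPerm_castLE]
    have := (κ ⟨x, hx⟩).isLt
    simp only [Fin.val_castLE]
    omega

theorem pInit_mul_extendPerm {n k : ℕ} (π : Equiv.Perm (Fin n)) (hk : k ≤ n)
    (κ : Equiv.Perm (Fin k)) : pInit (π * extendPerm hk κ) k hk = pInit π k hk * κ :=
  perm_eq_of_lt_iff fun i j => by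
    simp [pInit_lt_iff, extendPerm_castLE]

theorem pInit_extendPerm_mul {n k m : ℕ} (π : Equiv.Perm (Fin n)) (hk : k ≤ n) (hm : m ≤ n)
    (ρ : Equiv.Perm (Fin m)) (h : ∀ x : Fin n, (x : ℕ) < k → m ≤ (π x : ℕ)) :
    pInit (extendPerm hm ρ * π) k hk = pInit π k hk :=
  perm_eq_of_lt_iff fun i j => by
    simp [pInit_lt_iff, extendPerm_of_le hm ρ (h (Fin.castLE hk i) i.isLt),
      extendPerm_of_le hm ρ (h (Fin.castLE hk j) j.isLt)]

theorem vLow_extendPerm_mul {n k : ℕ} (π : Equiv.Perm (Fin n)) (hk : k ≤ n)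
    (ρ : Equiv.Perm (Fin k)) : vLow (extendPerm hk ρ * π) k hk = ρ * vLow π k hk := by
  rw [vLow, mul_inv_rev, ← map_inv, pInit_mul_extendPerm, mul_inv_rev, inv_inv, vLow]

theorem vLow_mul_extendPerm {n k m : ℕ} (π : Equiv.Perm (Fin n)) (hk : k ≤ n) (hm : m ≤ n)
    (κ : Equiv.Perm (Fin m)) (h : ∀ x : Fin n, (x : ℕ) < m → k ≤ (π x : ℕ)) :
    vLow (π * extendPerm hm κ) k hk = vLow π k hk := by
  rw [vLow, mul_inv_rev, ← map_inv, pInit_extendPerm_mul, vLow]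
  intro x hx
  by_contra! hlt
  have := h _ hlt
  rw [← Equiv.Perm.mul_apply, mul_inv_cancel, Equiv.Perm.one_apply] at this
  omega

/-- The permutations of `Fin n` whose first `b` letters are all at least `a`. -/
def separatedPerms (n a b : ℕ) : Finset (Equiv.Perm (Fin n)) :=
  Finset.univ.filter fun π => ∀ x : Fin n, (x : ℕ) < b → a ≤ (π x : ℕ)

theorem mem_separatedPerms {n a b : ℕ} {π : Equiv.Perm (Fin n)} :
    π ∈ separatedPerms n a b ↔ ∀ x : Fin n, (x : ℕ) < b → a ≤ (π x : ℕ) := by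
  simp [separatedPerms]

theorem extendPerm_mul_mul_extendPerm_mem_separatedPerms {n a b : ℕ} (ha : a ≤ n) (hb : b ≤ n)
    (ρ : Equiv.Perm (Fin a)) (κ : Equiv.Perm (Fin b)) {π : Equiv.Perm (Fin n)}
    (hπ : π ∈ separatedPerms n a b) :
    extendPerm ha ρ * π * extendPerm hb κ ∈ separatedPerms n a b := by
  rw [mem_separatedPerms] at hπ ⊢
  intro x hx
  rw [Equiv.Perm.mul_apply, Equiv.Perm.mul_apply, le_extendPerm_iff]
  apply hπ
  rw [← not_le, le_extendPerm_iff]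
  omega

theorem card_separatedPerms_filter_le {n a b : ℕ} (ha : a ≤ n) (hb : b ≤ n)
    (σ σ' : Equiv.Perm (Fin a)) (τ τ' : Equiv.Perm (Fin b)) :
    ((separatedPerms n a b).filter fun π => (vLow π a ha, pInit π b hb) = (σ, τ)).card ≤
      ((separatedPerms n a b).filter fun π => (vLow π a ha, pInit π b hb) = (σ', τ')).card := by
  refine Finset.card_le_card_of_injOn
    (fun π => extendPerm ha (σ' * σ⁻¹) * π * extendPerm hb (τ⁻¹ * τ')) ?_ ?_
  · intro π hπ
    simp only [Finset.coe_filter, Set.mem_ofPred_eq, Prod.mk.injEq] at hπ ⊢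
    obtain ⟨hs, rfl, rfl⟩ := hπ
    have h1 := mem_separatedPerms.1 hs
    refine ⟨extendPerm_mul_mul_extendPerm_mem_separatedPerms ha hb _ _ hs, ?_, ?_⟩
    · rw [mul_assoc, vLow_extendPerm_mul, vLow_mul_extendPerm _ _ _ _ h1]
      simp
    · rw [pInit_mul_extendPerm, pInit_extendPerm_mul _ _ _ _ h1]
      simp
  · intro π _ π' _ h
    simpa using h

theorem card_separatedPerms {n a b : ℕ} (ha : a ≤ n) (hb : b ≤ n)
    (σ : Equiv.Perm (Fin a)) (τ : Equiv.Perm (Fin b)) :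
    (separatedPerms n a b).card = a.factorial * b.factorial *
      ((separatedPerms n a b).filter fun π => (vLow π a ha, pInit π b hb) = (σ, τ)).card := by
  rw [Finset.card_eq_sum_card_fiberwise (f := fun π => (vLow π a ha, pInit π b hb))
      (t := Finset.univ) (fun _ _ => Finset.mem_coe.2 (Finset.mem_univ _)),
    Finset.sum_congr rfl fun p _ => (card_separatedPerms_filter_le ha hb p.1 σ p.2 τ).antisymm
      (card_separatedPerms_filter_le ha hb σ p.1 τ p.2)]
  simp [Fintype.card_perm]

theorem mul_card_perm_apply_eq {n : ℕ} (x y : Fin n) :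
    n * (Finset.univ.filter fun π : Equiv.Perm (Fin n) => π x = y).card = n.factorial := by
  have hle : ∀ y z : Fin n, (Finset.univ.filter fun π : Equiv.Perm (Fin n) => π x = y).card ≤
      (Finset.univ.filter fun π : Equiv.Perm (Fin n) => π x = z).card := fun y z => by
    refine Finset.card_le_card_of_injOn (fun π => Equiv.swap y z * π) ?_ ?_
    · intro π hπ
      simp only [Finset.coe_filter, Finset.mem_univ, true_and, Set.mem_ofPred_eq] at hπ ⊢
      simp [hπ]
    · intro π _ π' _ h
      simpa using h
  have h := Finset.card_eq_sum_card_fiberwise (s := Finset.univ)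
    (f := fun π : Equiv.Perm (Fin n) => π x) (t := Finset.univ)
    (fun _ _ => Finset.mem_coe.2 (Finset.mem_univ _))
  rw [Finset.sum_congr rfl fun z _ => (hle z y).antisymm (hle y z)] at h
  simpa [Fintype.card_perm] using h.symm

theorem mul_card_compl_separatedPerms_le {n a b : ℕ} (ha : a ≤ n) (hb : b ≤ n) :
    n * (separatedPerms n a b)ᶜ.card ≤ a * b * n.factorial := by
  have hsub : (separatedPerms n a b)ᶜ ⊆ (Finset.univ : Finset (Fin a × Fin b)).biUnion fun p =>
      Finset.univ.filter fun π : Equiv.Perm (Fin n) =>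
        π (Fin.castLE hb p.2) = Fin.castLE ha p.1 := by
    intro π hπ
    simp only [Finset.mem_compl, mem_separatedPerms, not_forall, not_le] at hπ
    obtain ⟨x, hx, hy⟩ := hπ
    simp only [Finset.mem_biUnion, Finset.mem_univ, Finset.mem_filter, true_and]
    exact ⟨(⟨π x, hy⟩, ⟨x, hx⟩), rfl⟩
  calc n * (separatedPerms n a b)ᶜ.card
      ≤ n * ∑ p : Fin a × Fin b, (Finset.univ.filter fun π : Equiv.Perm (Fin n) =>
        π (Fin.castLE hb p.2) = Fin.castLE ha p.1).card :=
        Nat.mul_le_mul_left _ ((Finset.card_le_card hsub).trans Finset.card_biUnion_le)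
    _ = a * b * n.factorial := by
        rw [Finset.mul_sum, Finset.sum_congr rfl fun p _ => mul_card_perm_apply_eq _ _]
        simp

theorem abs_card_permsC_div_factorial_sub_le {n a b : ℕ} (ha : a ≤ n) (hb : b ≤ n) (hn : 0 < n)
    (σ : Equiv.Perm (Fin a)) (τ : Equiv.Perm (Fin b)) :
    |((permsC n σ τ).card : ℝ) / (n.factorial : ℝ) -
      1 / ((a.factorial : ℝ) * (b.factorial : ℝ))| ≤ (a * b : ℝ) / n := by
  set F := (separatedPerms n a b).filter fun π => (vLow π a ha, pInit π b hb) = (σ, τ) with hF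
  have hmem : ∀ π, π ∈ permsC n σ τ ↔ vLow π a ha = σ ∧ pInit π b hb = τ := fun π => by
    simp [permsC, ha, hb]
  have hlow : F.card ≤ (permsC n σ τ).card := Finset.card_le_card fun π hπ => by
    simpa [hmem] using (Finset.mem_filter.1 hπ).2
  have hupp : (permsC n σ τ).card ≤ F.card + (separatedPerms n a b)ᶜ.card := by
    refine (Finset.card_le_card fun π hπ => ?_).trans (Finset.card_union_le _ _)
    rw [hmem] at hπ
    simp only [hF, Finset.mem_union, Finset.mem_filter, Finset.mem_compl, Prod.mk.injEq]
    tauto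
  have hsum := Finset.card_add_card_compl (separatedPerms n a b)
  rw [card_separatedPerms ha hb σ τ, ← hF, Fintype.card_perm, Fintype.card_fin] at hsum
  have hcompl := mul_card_compl_separatedPerms_le ha hb
  set e := (separatedPerms n a b)ᶜ.card
  have hN : (0 : ℝ) < n.factorial := by exact_mod_cast n.factorial_pos
  have hab : (1 : ℝ) ≤ a.factorial * b.factorial := by
    exact_mod_cast Nat.mul_pos a.factorial_pos b.factorial_pos
  have hn' : (0 : ℝ) < n := by exact_mod_cast hn
  have hsum' : (a.factorial * b.factorial * F.card + e : ℝ) = n.factorial := by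
    exact_mod_cast hsum
  have hlow' : (F.card : ℝ) ≤ (permsC n σ τ).card := by exact_mod_cast hlow
  have hupp' : ((permsC n σ τ).card : ℝ) ≤ F.card + e := by exact_mod_cast hupp
  have he : (e : ℝ) / n.factorial ≤ (a * b : ℝ) / n := by
    rw [div_le_div_iff₀ hN hn']
    exact_mod_cast (mul_comm _ _).trans_le hcompl
  refine le_trans ?_ he
  set P : ℝ := a.factorial * b.factorial
  have hP : 0 < P := by linarith
  have hrw : ((permsC n σ τ).card : ℝ) / (n.factorial : ℝ) - 1 / P =
      ((permsC n σ τ).card - F.card - e / P) / n.factorial := by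
    rw [← hsum'] at hN ⊢
    field_simp
    ring
  have heP : (e : ℝ) / P ≤ e := div_le_self (Nat.cast_nonneg _) hab
  have heP0 : (0 : ℝ) ≤ e / P := by positivity
  rw [hrw, abs_div, abs_of_pos hN]
  gcongr
  rw [abs_le]
  constructor <;> linarith

/-- For `σ ∈ S_a` and `τ ∈ S_b`,
`|S_n(σ,τ)|/n! → 1/(a! b!)` as `n → ∞`. -/
theorem stmt8 {a b : ℕ} (σ : Equiv.Perm (Fin a)) (τ : Equiv.Perm (Fin b)) :
    Filter.Tendsto (fun n : ℕ => ((permsC n σ τ).card : ℝ) / (n.factorial : ℝ))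
      Filter.atTop (nhds (1 / ((a.factorial : ℝ) * (b.factorial : ℝ)))) := by
  rw [tendsto_iff_norm_sub_tendsto_zero]
  refine squeeze_zero' (Filter.Eventually.of_forall fun _ => norm_nonneg _) ?_
    (tendsto_const_div_atTop_nhds_zero_nat (a * b : ℝ))
  filter_upwards [Filter.eventually_ge_atTop a, Filter.eventually_ge_atTop b,
    Filter.eventually_gt_atTop 0] with n ha hb hn
  exact abs_card_permsC_div_factorial_sub_le ha hb hn σ τ

end QT
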